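/- Let K be a difference subfield of U with σ(K) = K, and let a be a finite tuple with σ(a) ∈ K(a)^alg and μ(σ(a)/K(a)) = ld(a/K). Note that σ maps K(a)^alg into itself. Let τ be a field automorphism of K(a)^alg fixing K(a) pointwise, and let K(a)_{στ} := K((στ)^i(a) : i ∈ ℕ). Then the difference fields (K(a)_σ, σ) and (K(a)_{στ}, στ) are isomorphic: there is a field isomorphism f : K(a)_σ → K(a)_{στ} fixing K pointwise, sending a to a, and satisfying f ∘ σ = (στ) ∘ f on K(a)_σ. -/

import Mathlib

/- Setting: a large algebraically closed field `U` with an automorphism `σ`.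
   Tuples are maps `Fin n → U`; for a tuple `t`, the relevant set of coordinates
   is `Set.range t`.  `fAdj E s` is the subfield `E(s)` generated by a subfield
   `E` and a set `s`, and `deg E s` is the degree `μ(s/E) = [E(s):E]`. -/

set_option maxHeartbeats 1000000
set_option synthInstance.maxHeartbeats 1000000

open Filter Set

variable {U : Type*}

/-- The subfield `E(s)` generated by the subfield `E` and the set `s`. -/
noncomputable def fAdj [Field U] (E : Subfield U) (s : Set U) : Subfield U :=
  (IntermediateField.adjoin E s).toSubfield

/-- The degree `μ(s/E) = [E(s):E]` (as `Module.finrank`; it is `0` when infinite). -/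
noncomputable def deg [Field U] (E : Subfield U) (s : Set U) : ℕ :=
  Module.finrank E (IntermediateField.adjoin E s)

/-- `k ↦ μ(σ^{k+1}(s) / K(s, σ(s), …, σ^k(s)))`: the sequence whose eventual
value is the limit degree `ld(s/K)`. -/
noncomputable def ldSeq [Field U] (σ : U ≃+* U) (K : Subfield U) (s : Set U) (k : ℕ) : ℕ :=
  deg (fAdj K (⋃ i ∈ Set.Iic k, ⇑(σ ^ i) '' s)) (⇑(σ ^ (k + 1)) '' s)

/-- `k ↦ μ(σ^k(s) / K(s))`: the sequence whose `k`-th roots converge to the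
distant degree `dd(s/K)`. -/
noncomputable def ddSeq [Field U] (σ : U ≃+* U) (K : Subfield U) (s : Set U) (k : ℕ) : ℕ :=
  deg (fAdj K s) (⇑(σ ^ k) '' s)

/-- The inversive closure `K^inv = ⋃ₙ σ^{-n}(K)`. -/
noncomputable def Kinv [Field U] (σ : U ≃+* U) (K : Subfield U) : Subfield U :=
  ⨆ n : ℕ, K.map (σ⁻¹ ^ n : U ≃+* U).toRingHom

/-- The difference field `K(s)_σ = K(σ^i(s) : i ∈ ℕ)` generated by `s` over `K`. -/
noncomputable def diffAdj [Field U] (σ : U ≃+* U) (K : Subfield U) (s : Set U) : Subfield U :=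
  fAdj K (⋃ i : ℕ, ⇑(σ ^ i) '' s)

open scoped TensorProduct in
/-- If `L` and `A` are extensions of `E` such that `A` spans the compositum `M` over `L` and
`[M : L] = [A : E]`, then compatible embeddings of `L` and `A` extend to `M`. -/
theorem exists_algHom_of_span_eq_top {E L A M V : Type*} [Field E] [Field L] [Field A] [Field M]
    [Field V] [Algebra E L] [Algebra E A] [Algebra L M] [Algebra E M] [IsScalarTower E L M]
    [Algebra E V] [FiniteDimensional E A] [FiniteDimensional L M] (j : A →ₐ[E] M)
    (hspan : Submodule.span L (Set.range j) = ⊤)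
    (hrank : Module.finrank L M = Module.finrank E A) (φ : L →ₐ[E] V) (ψ : A →ₐ[E] V) :
    ∃ χ : M →ₐ[E] V, (∀ x, χ (algebraMap L M x) = φ x) ∧ ∀ x, χ (j x) = ψ x := by
  let θ : TensorProduct E L A →ₐ[L] M :=
    Algebra.TensorProduct.lift (Algebra.ofId L M) j fun _ _ => Commute.all _ _
  have hsurj : Function.Surjective θ := by
    have h : Submodule.span L (Set.range j) ≤ LinearMap.range θ.toLinearMap := by
      rw [Submodule.span_le]
      rintro _ ⟨x, rfl⟩
      exact ⟨1 ⊗ₜ[E] x, by simp [θ]⟩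
    rw [hspan] at h
    intro x
    exact h (Submodule.mem_top (x := x))
  have hinj : Function.Injective θ := by
    have hfr : Module.finrank L (TensorProduct E L A) = Module.finrank L M := by
      rw [Module.finrank_baseChange, hrank]
    have hsurj' : Function.Surjective θ.toLinearMap := hsurj
    exact (LinearMap.injective_iff_surjective_of_finrank_eq_finrank hfr).2 hsurj'
  let e : TensorProduct E L A ≃ₐ[L] M := AlgEquiv.ofBijective θ ⟨hinj, hsurj⟩
  have he : ∀ y, e y = θ y := fun _ => rfl
  let ρ : TensorProduct E L A →ₐ[E] V :=
    Algebra.TensorProduct.lift φ ψ fun _ _ => Commute.all _ _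
  refine ⟨ρ.comp (e.symm.toAlgHom.restrictScalars E), fun x => ?_, fun x => ?_⟩
  · have : e (x ⊗ₜ[E] 1) = algebraMap L M x := by simp [he, θ]
    simp [← this, ρ]
  · have : e (1 ⊗ₜ[E] x) = j x := by simp [he, θ]
    simp [← this, ρ]

/-- The field generated over the larger base `L` is spanned by the field generated over `E`. -/
theorem span_adjoin_eq_adjoin {E L U : Type*} [Field E] [Field L] [Field U] [Algebra E L]
    [Algebra L U] [Algebra E U] [IsScalarTower E L U] {S : Set U}
    (hS : ∀ x ∈ S, IsAlgebraic E x) :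
    Submodule.span L (IntermediateField.adjoin E S : Set U) =
      Subalgebra.toSubmodule (IntermediateField.adjoin L S).toSubalgebra := by
  rw [IntermediateField.adjoin_toSubalgebra_of_isAlgebraic fun x hx => (hS x hx).tower_top L]
  apply le_antisymm
  · rw [Submodule.span_le, ← IntermediateField.coe_toSubalgebra,
      IntermediateField.adjoin_toSubalgebra_of_isAlgebraic hS]
    have h : Algebra.adjoin E S ≤ (Algebra.adjoin L S).restrictScalars E :=
      Algebra.adjoin_le (Algebra.subset_adjoin (R := L))
    exact h
  · rw [Algebra.adjoin_eq_span]
    refine Submodule.span_mono ?_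
    intro x hx
    have : Submonoid.closure S ≤
        (IntermediateField.adjoin E S).toSubalgebra.toSubsemiring.toSubmonoid :=
      Submonoid.closure_le.2 (IntermediateField.subset_adjoin E S)
    exact this hx

section DifferenceField

variable [Field U]

theorem subset_fAdj (E : Subfield U) (s : Set U) : s ⊆ fAdj E s :=
  IntermediateField.subset_adjoin E s

theorem le_fAdj (E : Subfield U) (s : Set U) : E ≤ fAdj E s := fun x hx =>
  (IntermediateField.adjoin E s).algebraMap_mem ⟨x, hx⟩

theorem fAdj_le {E F : Subfield U} {s : Set U} (hE : E ≤ F) (hs : s ⊆ F) : fAdj E s ≤ F := by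
  intro x hx
  have : IntermediateField.adjoin E s ≤ Subfield.toIntermediateField F fun x => hE x.2 :=
    IntermediateField.adjoin_le_iff.2 hs
  exact this hx

theorem fAdj_mono {E F : Subfield U} {s t : Set U} (hE : E ≤ F) (hs : s ⊆ t) :
    fAdj E s ≤ fAdj F t :=
  fAdj_le (hE.trans (le_fAdj F t)) (hs.trans (subset_fAdj F t))

theorem fAdj_fAdj (E : Subfield U) (s t : Set U) : fAdj (fAdj E s) t = fAdj E (s ∪ t) :=
  le_antisymm
    (fAdj_le (fAdj_mono le_rfl subset_union_left) (subset_union_right.trans (subset_fAdj _ _)))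
    (fAdj_le ((le_fAdj _ _).trans (le_fAdj _ _))
      (union_subset ((subset_fAdj E s).trans (le_fAdj (fAdj E s) t)) (subset_fAdj _ _)))

theorem map_fAdj (σ : U ≃+* U) (E : Subfield U) (s : Set U) :
    (fAdj E s).map σ.toRingHom = fAdj (E.map σ.toRingHom) (σ '' s) := by
  apply le_antisymm
  · rw [Subfield.map_le_iff_le_comap]
    refine fAdj_le (Subfield.map_le_iff_le_comap.1 (le_fAdj _ _)) fun x hx => ?_
    exact subset_fAdj _ _ (mem_image_of_mem σ hx)
  · refine fAdj_le ((Subfield.gc_map_comap _).monotone_l (le_fAdj E s)) ?_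
    rintro _ ⟨x, hx, rfl⟩
    exact ⟨x, subset_fAdj E s hx, rfl⟩

/-- Ring homomorphisms out of `E(s)` are determined by their values on `E` and `s`. -/
theorem fAdj_ringHom_ext {V : Type*} [Field V] {E : Subfield U} {s : Set U}
    {φ ψ : fAdj E s →+* V} (hE : ∀ x : fAdj E s, (x : U) ∈ E → φ x = ψ x)
    (hs : ∀ x : fAdj E s, (x : U) ∈ s → φ x = ψ x) : φ = ψ := by
  have h : fAdj E s ≤ (φ.eqLocusField ψ).map (fAdj E s).subtype :=
    fAdj_le (fun x hx => ⟨⟨x, le_fAdj E s hx⟩, hE _ hx, rfl⟩)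
      fun x hx => ⟨⟨x, subset_fAdj E s hx⟩, hs _ hx, rfl⟩
  ext x
  obtain ⟨y, hy, hyx⟩ := h x.2
  obtain rfl : y = x := Subtype.ext hyx
  exact hy

theorem isAlgebraic_mono {E L : Subfield U} (h : E ≤ L) {x : U} (hx : IsAlgebraic E x) :
    IsAlgebraic L x := by
  let _ : Algebra E L := (Subfield.inclusion h).toAlgebra
  have : IsScalarTower E L U := IsScalarTower.of_algebraMap_eq fun _ => rfl
  exact hx.tower_top L

/-- A field automorphism restricts to an isomorphism from a subfield onto its image. -/
noncomputable def subfieldMapEquiv (σ : U ≃+* U) (E : Subfield U) : E ≃+* E.map σ.toRingHom :=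
  σ.subringMap (s := E.toSubring)

theorem isAlgebraic_map (σ : U ≃+* U) {E : Subfield U} {x : U} (hx : IsAlgebraic E x) :
    IsAlgebraic (E.map σ.toRingHom) (σ x) :=
  (isAlgebraic_ringHom_iff_of_comp_eq (subfieldMapEquiv σ E) σ σ.injective rfl).2 hx

theorem finiteDimensional_fAdj {E : Subfield U} {S : Set U} (hfin : S.Finite)
    (hS : ∀ x ∈ S, IsAlgebraic E x) : FiniteDimensional E (IntermediateField.adjoin E S) := by
  have := hfin.to_subtype
  exact IntermediateField.finiteDimensional_adjoin fun x hx => (hS x hx).isIntegral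

theorem deg_map (σ : U ≃+* U) (E : Subfield U) (S : Set U) :
    deg (E.map σ.toRingHom) (σ '' S) = deg E S := by
  let e : IntermediateField.adjoin E S ≃+*
      IntermediateField.adjoin (E.map σ.toRingHom) (σ '' S) :=
    (subfieldMapEquiv σ (fAdj E S)).trans (RingEquiv.subfieldCongr (map_fAdj σ E S))
  exact (Algebra.finrank_eq_of_equiv_equiv (subfieldMapEquiv σ E) e rfl).symm

theorem deg_le_of_le {E L : Subfield U} (h : E ≤ L) {S : Set U} (hfin : S.Finite)
    (hS : ∀ x ∈ S, IsAlgebraic E x) : deg L S ≤ deg E S := by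
  let _ : Algebra E L := (Subfield.inclusion h).toAlgebra
  have : IsScalarTower E L U := IsScalarTower.of_algebraMap_eq fun _ => rfl
  have := finiteDimensional_fAdj hfin hS
  let b := Module.finBasis E (IntermediateField.adjoin E S)
  have hspan := span_adjoin_eq_adjoin (L := L) hS
  have hb : Submodule.span L (IntermediateField.adjoin E S : Set U) =
      Submodule.span L (Set.range fun i => (b i : U)) := by
    refine le_antisymm (Submodule.span_le.2 fun x hx => ?_) (Submodule.span_mono ?_)
    · have := b.sum_repr ⟨x, hx⟩
      have h2 := congrArg Subtype.val this
      rw [← show _ = x from h2]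
      rw [IntermediateField.coe_sum]
      refine Submodule.sum_mem _ fun i _ => ?_
      exact Submodule.smul_mem _ (algebraMap E L (b.repr ⟨x, hx⟩ i))
        (Submodule.subset_span ⟨i, rfl⟩)
    · rintro _ ⟨i, rfl⟩
      exact (b i).2
  have hle := finrank_range_le_card (R := L) fun i => (b i : U)
  rw [Set.finrank, ← hb, hspan, Fintype.card_fin] at hle
  exact hle

/-- If `[L(S) : L] = [E(S) : E]` is finite, then embeddings of `L` and `E(S)` agreeing on `E`
have a common extension to `L(S)`. -/
theorem exists_ringHom_fAdj {V : Type*} [Field V] {E L : Subfield U} (h : E ≤ L) {S : Set U}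
    (hfin : S.Finite) (hS : ∀ x ∈ S, IsAlgebraic E x) (hdeg : deg L S = deg E S)
    (φ : L →+* V) (ψ : fAdj E S →+* V)
    (hφψ : ∀ x : E, φ (Subfield.inclusion h x) = ψ (Subfield.inclusion (le_fAdj E S) x)) :
    ∃ χ : fAdj L S →+* V, (∀ x, χ (Subfield.inclusion (le_fAdj L S) x) = φ x) ∧
      ∀ x, χ (Subfield.inclusion (fAdj_mono h subset_rfl) x) = ψ x := by
  let _ : Algebra E L := (Subfield.inclusion h).toAlgebra
  have : IsScalarTower E L U := IsScalarTower.of_algebraMap_eq fun _ => rfl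
  let _ : Algebra E V := (φ.comp (Subfield.inclusion h)).toAlgebra
  have := finiteDimensional_fAdj hfin hS
  have := finiteDimensional_fAdj hfin fun x hx => isAlgebraic_mono h (hS x hx)
  let j : IntermediateField.adjoin E S →ₐ[E] IntermediateField.adjoin L S :=
    { Subfield.inclusion (fAdj_mono h (subset_refl S)) with commutes' := fun _ => rfl }
  let φ' : L →ₐ[E] V := { φ with commutes' := fun _ => rfl }
  let ψ' : IntermediateField.adjoin E S →ₐ[E] V :=
    { ψ with commutes' := fun x => (hφψ x).symm }
  have hspan : Submodule.span L (Set.range j) = ⊤ := by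
    have hle : Submodule.span L (IntermediateField.adjoin E S : Set U) ≤
        (Submodule.span L (Set.range j)).map (IntermediateField.adjoin L S).val.toLinearMap :=
      Submodule.span_le.2 fun x hx => ⟨j ⟨x, hx⟩, Submodule.subset_span ⟨_, rfl⟩, rfl⟩
    rw [span_adjoin_eq_adjoin hS] at hle
    refine Submodule.eq_top_iff'.2 fun x => ?_
    obtain ⟨y, hy, hyx⟩ := hle x.2
    obtain rfl : y = x := Subtype.ext hyx
    exact hy
  obtain ⟨χ, h1, h2⟩ := exists_algHom_of_span_eq_top j hspan hdeg φ' ψ'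
  exact ⟨χ.toRingHom, h1, h2⟩

/-- A compatible sequence of ring homomorphisms on an increasing chain of subfields glues to the
union of the chain. -/
theorem exists_ringHom_of_chain {V : Type*} [Field V] {T : ℕ → Subfield U} (hT : Monotone T)
    {D : Subfield U} (hD : ∀ x, x ∈ D ↔ ∃ k, x ∈ T k) (F : ∀ k, T k →+* V)
    (hF : ∀ k x, F (k + 1) (Subfield.inclusion (hT k.le_succ) x) = F k x) :
    ∃ f : D →+* V, ∀ k (x : T k), f ⟨x, (hD x).2 ⟨k, x.2⟩⟩ = F k x := by
  have hstep : ∀ k m (hkm : k ≤ m) (x : U) (hk : x ∈ T k), F m ⟨x, hT hkm hk⟩ = F k ⟨x, hk⟩ := by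
    intro k m hkm x hk
    induction m, hkm using Nat.le_induction with
    | base => rfl
    | succ m hkm ih => exact (hF m ⟨x, hT hkm hk⟩).trans ih
  have hindep : ∀ k m (x : U) (hk : x ∈ T k) (hm : x ∈ T m), F m ⟨x, hm⟩ = F k ⟨x, hk⟩ := by
    intro k m x hk hm
    rcases le_total k m with h | h
    · exact hstep k m h x hk
    · exact (hstep m k h x hm).symm
  choose N hN using fun x : D => (hD x).1 x.2
  have hval : ∀ k (x : D) (hx : (x : U) ∈ T k), F (N x) ⟨x, hN x⟩ = F k ⟨x, hx⟩ :=
    fun k x hx => hindep k (N x) x hx (hN x)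
  refine ⟨{ toFun := fun x => F (N x) ⟨x, hN x⟩, map_one' := ?_, map_zero' := ?_,
            map_mul' := fun x y => ?_, map_add' := fun x y => ?_ },
    fun k x => hval k _ x.2⟩
  · exact map_one (F (N 1))
  · have hx := hT (le_max_left (N x) (N y)) (hN x)
    have hy := hT (le_max_right (N x) (N y)) (hN y)
    rw [hval _ x hx, hval _ y hy, hval _ (x * y) (mul_mem hx hy), ← map_mul]
    rfl
  · exact map_zero (F (N 0))
  · have hx := hT (le_max_left (N x) (N y)) (hN x)
    have hy := hT (le_max_right (N x) (N y)) (hN y)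
    rw [hval _ x hx, hval _ y hy, hval _ (x + y) (add_mem hx hy), ← map_add]
    rfl

theorem inclusion_inclusion {E F L : Subfield U} (hEF : E ≤ F) (hFL : F ≤ L) (hEL : E ≤ L)
    (x : E) :
    Subfield.inclusion hFL (Subfield.inclusion hEF x) = Subfield.inclusion hEL x :=
  rfl

/-- The field `K(s, σ(s), …, σ^k(s))`. -/
noncomputable def partialDiffAdj (σ : U ≃+* U) (K : Subfield U) (s : Set U) (k : ℕ) :
    Subfield U :=
  fAdj K (⋃ i ∈ Set.Iic k, ⇑(σ ^ i) '' s)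

theorem image_pow_succ (σ : U ≃+* U) (s : Set U) (i : ℕ) :
    ⇑(σ ^ (i + 1)) '' s = σ '' (⇑(σ ^ i) '' s) := by
  rw [image_image, pow_succ']
  rfl

theorem partialDiffAdj_zero (σ : U ≃+* U) (K : Subfield U) (s : Set U) :
    partialDiffAdj σ K s 0 = fAdj K s := by
  simp [partialDiffAdj]

theorem partialDiffAdj_succ (σ : U ≃+* U) (K : Subfield U) (s : Set U) (k : ℕ) :
    partialDiffAdj σ K s (k + 1) =
      fAdj (partialDiffAdj σ K s k) (⇑(σ ^ (k + 1)) '' s) := by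
  rw [partialDiffAdj, partialDiffAdj, fAdj_fAdj]
  congr 1
  ext x
  simp only [mem_iUnion, mem_Iic, mem_union, Nat.le_succ_iff]
  grind

theorem partialDiffAdj_mono (σ : U ≃+* U) (K : Subfield U) (s : Set U) :
    Monotone (partialDiffAdj σ K s) := fun _ _ h =>
  fAdj_mono le_rfl (biUnion_subset_biUnion_left (Iic_subset_Iic.2 h))

theorem map_partialDiffAdj_succ (σ : U ≃+* U) (K : Subfield U) (s : Set U) (k : ℕ) :
    (partialDiffAdj σ K s (k + 1)).map σ.toRingHom =
      fAdj ((partialDiffAdj σ K s k).map σ.toRingHom) (⇑(σ ^ (k + 1 + 1)) '' s) := by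
  rw [partialDiffAdj_succ, map_fAdj, image_pow_succ σ s (k + 1)]

theorem map_partialDiffAdj_le (σ : U ≃+* U) {K : Subfield U} (hK : K.map σ.toRingHom ≤ K)
    (s : Set U) (k : ℕ) :
    (partialDiffAdj σ K s k).map σ.toRingHom ≤ partialDiffAdj σ K s (k + 1) := by
  rw [partialDiffAdj, partialDiffAdj, map_fAdj]
  refine fAdj_mono hK ?_
  rw [image_iUnion₂]
  refine iUnion₂_subset fun i hi => ?_
  rw [← image_pow_succ]
  exact subset_biUnion_of_mem (u := fun i => ⇑(σ ^ i) '' s) (Nat.succ_le_succ hi)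

theorem mem_diffAdj_iff (σ : U ≃+* U) (K : Subfield U) (s : Set U) (x : U) :
    x ∈ diffAdj σ K s ↔ ∃ k, x ∈ partialDiffAdj σ K s k := by
  constructor
  · intro hx
    have hdir := (partialDiffAdj_mono σ K s).directed_le
    rw [← Subfield.mem_iSup_of_directed hdir]
    refine fAdj_le ((le_fAdj K _).trans (le_iSup (partialDiffAdj σ K s) 0)) ?_ hx
    refine iUnion_subset fun i => ?_
    have h : ⇑(σ ^ i) '' s ⊆ partialDiffAdj σ K s i :=
      (subset_biUnion_of_mem (u := fun i => ⇑(σ ^ i) '' s) (self_mem_Iic (a := i))).trans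
        (subset_fAdj K _)
    exact h.trans (le_iSup (partialDiffAdj σ K s) i)
  · rintro ⟨k, hk⟩
    exact fAdj_mono le_rfl (iUnion₂_subset_iUnion _ _) hk

theorem map_diffAdj_le (σ : U ≃+* U) {K : Subfield U} (hK : K.map σ.toRingHom ≤ K)
    {s : Set U} {x : U} (hx : x ∈ diffAdj σ K s) : σ x ∈ diffAdj σ K s := by
  obtain ⟨k, hk⟩ := (mem_diffAdj_iff σ K s x).1 hx
  exact (mem_diffAdj_iff σ K s _).2 ⟨k + 1, map_partialDiffAdj_le σ hK s k ⟨x, hk, rfl⟩⟩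

section LimitDegree

variable (σ : U ≃+* U) {K : Subfield U} {s : Set U}

theorem isAlgebraic_image_pow_succ (hK : K.map σ.toRingHom ≤ K)
    (hs : ∀ x ∈ s, IsAlgebraic (fAdj K s) (σ x)) (k : ℕ) :
    ∀ x ∈ ⇑(σ ^ (k + 1)) '' s, IsAlgebraic (partialDiffAdj σ K s k) x := by
  induction k with
  | zero =>
    rw [partialDiffAdj_zero]
    rintro _ ⟨x, hx, rfl⟩
    simpa using hs x hx
  | succ k ih =>
    rw [image_pow_succ]
    rintro _ ⟨x, hx, rfl⟩
    exact isAlgebraic_mono (map_partialDiffAdj_le σ hK s k) (isAlgebraic_map σ (ih x hx))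

theorem deg_map_partialDiffAdj (k : ℕ) :
    deg ((partialDiffAdj σ K s k).map σ.toRingHom) (⇑(σ ^ (k + 1 + 1)) '' s) = ldSeq σ K s k := by
  rw [image_pow_succ, deg_map]
  rfl

theorem isAlgebraic_map_partialDiffAdj (hK : K.map σ.toRingHom ≤ K)
    (hs : ∀ x ∈ s, IsAlgebraic (fAdj K s) (σ x)) (k : ℕ) :
    ∀ x ∈ ⇑(σ ^ (k + 1 + 1)) '' s,
      IsAlgebraic ((partialDiffAdj σ K s k).map σ.toRingHom) x := by
  rw [image_pow_succ]
  rintro _ ⟨x, hx, rfl⟩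
  exact isAlgebraic_map σ (isAlgebraic_image_pow_succ σ hK hs k x hx)

theorem antitone_ldSeq (hK : K.map σ.toRingHom ≤ K) (hfin : s.Finite)
    (hs : ∀ x ∈ s, IsAlgebraic (fAdj K s) (σ x)) : Antitone (ldSeq σ K s) := by
  refine antitone_nat_of_succ_le fun k => ?_
  refine le_of_le_of_eq ?_ (deg_map_partialDiffAdj σ k)
  exact deg_le_of_le (map_partialDiffAdj_le σ hK s k) (hfin.image _)
    (isAlgebraic_map_partialDiffAdj σ hK hs k)

/-- If `μ(σ(s)/K(s))` is the limit degree, then the sequence defining the latter is constant. -/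
theorem ldSeq_eq (hK : K.map σ.toRingHom ≤ K) (hfin : s.Finite)
    (hs : ∀ x ∈ s, IsAlgebraic (fAdj K s) (σ x)) {d : ℕ}
    (hd : ∀ᶠ k in atTop, ldSeq σ K s k = d) (hmu : deg (fAdj K s) (σ '' s) = d) (k : ℕ) :
    ldSeq σ K s k = d := by
  have hanti := antitone_ldSeq σ hK hfin hs
  have h0 : ldSeq σ K s 0 = d := by
    rw [← hmu]
    have : ldSeq σ K s 0 = deg (partialDiffAdj σ K s 0) (⇑(σ ^ 1) '' s) := rfl
    rw [this, partialDiffAdj_zero, pow_one]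
  obtain ⟨m, hm, hkm⟩ := (hd.and (eventually_ge_atTop k)).exists
  exact le_antisymm (h0 ▸ hanti (Nat.zero_le k)) (hm ▸ hanti hkm)

/-- One extension step: an equivariant pair of embeddings of `K(s, …, σ^k(s))` and
`K(s, …, σ^(k+1)(s))` continues to `K(s, …, σ^(k+2)(s))`. -/
theorem exists_equivariant_extension {V : Type*} [Field V] (γ : V →+* V)
    (hK : K.map σ.toRingHom ≤ K) (hfin : s.Finite)
    (hs : ∀ x ∈ s, IsAlgebraic (fAdj K s) (σ x)) (k : ℕ)
    (hdeg : ldSeq σ K s (k + 1) = ldSeq σ K s k)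
    (f : partialDiffAdj σ K s k →+* V) (f' : partialDiffAdj σ K s (k + 1) →+* V)
    (hff' : ∀ x, f' (Subfield.inclusion (partialDiffAdj_mono σ K s k.le_succ) x) = f x)
    (hσ : ∀ x : partialDiffAdj σ K s k,
      f' ⟨σ x, map_partialDiffAdj_le σ hK s k ⟨x, x.2, rfl⟩⟩ = γ (f x)) :
    ∃ f'' : partialDiffAdj σ K s (k + 1 + 1) →+* V,
      (∀ x, f'' (Subfield.inclusion (partialDiffAdj_mono σ K s (k + 1).le_succ) x) = f' x) ∧
      ∀ x : partialDiffAdj σ K s (k + 1),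
        f'' ⟨σ x, map_partialDiffAdj_le σ hK s (k + 1) ⟨x, x.2, rfl⟩⟩ = γ (f' x) := by
  obtain ⟨e, he⟩ : ∃ e : fAdj ((partialDiffAdj σ K s k).map σ.toRingHom)
      (⇑(σ ^ (k + 1 + 1)) '' s) →+* partialDiffAdj σ K s (k + 1),
      ∀ x (hx : x ∈ partialDiffAdj σ K s (k + 1)) h, e ⟨σ x, h⟩ = ⟨x, hx⟩ := by
    refine ⟨(σ.symm.toRingHom.comp (Subfield.subtype _)).codRestrict _ fun x => ?_,
      fun x hx h => Subtype.ext (σ.symm_apply_apply x)⟩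
    obtain ⟨y, hy, hyx⟩ := (map_partialDiffAdj_succ σ K s k).ge x.2
    have : σ.symm (x : U) = y := (RingEquiv.symm_apply_eq σ).2 hyx.symm
    exact this ▸ hy
  have hdeg' : deg (partialDiffAdj σ K s (k + 1)) (⇑(σ ^ (k + 1 + 1)) '' s) =
      deg ((partialDiffAdj σ K s k).map σ.toRingHom) (⇑(σ ^ (k + 1 + 1)) '' s) :=
    hdeg.trans (deg_map_partialDiffAdj σ k).symm
  have hagree : ∀ x : (partialDiffAdj σ K s k).map σ.toRingHom,
      f' (Subfield.inclusion (map_partialDiffAdj_le σ hK s k) x) =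
        (γ.comp f').comp e (Subfield.inclusion (le_fAdj _ _) x) := by
    rintro ⟨_, x, hx, rfl⟩
    rw [RingHom.comp_apply, RingHom.comp_apply]
    refine (hσ ⟨x, hx⟩).trans ?_
    rw [← hff']
    exact congrArg (fun y => γ (f' y))
      (he x (partialDiffAdj_mono σ K s k.le_succ hx) _).symm
  obtain ⟨χ, h1, h2⟩ := exists_ringHom_fAdj (map_partialDiffAdj_le σ hK s k) (hfin.image _)
    (isAlgebraic_map_partialDiffAdj σ hK hs k) hdeg' f' ((γ.comp f').comp e) hagree
  refine ⟨χ.comp (Subfield.inclusion (partialDiffAdj_succ σ K s (k + 1)).le),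
    fun x => ?_, fun x => ?_⟩
  · rw [RingHom.comp_apply]
    exact (congrArg χ (inclusion_inclusion _ _ _ x)).trans (h1 x)
  · have hx : σ (x : U) ∈ fAdj ((partialDiffAdj σ K s k).map σ.toRingHom)
        (⇑(σ ^ (k + 1 + 1)) '' s) := by
      rw [← map_partialDiffAdj_succ]
      exact ⟨x, x.2, rfl⟩
    rw [RingHom.comp_apply]
    refine (h2 ⟨σ x, hx⟩).trans ?_
    rw [RingHom.comp_apply, RingHom.comp_apply, he x x.2 hx]

/-- If the limit degree is already attained by `μ(σ(s)/K(s))`, then an embedding of `K(s, σ(s))`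
that is equivariant on `K(s)` extends to an equivariant embedding of `K(s)_σ`. -/
theorem exists_equivariant_ringHom {V : Type*} [Field V] (γ : V →+* V)
    (hK : K.map σ.toRingHom ≤ K) (hfin : s.Finite)
    (hs : ∀ x ∈ s, IsAlgebraic (fAdj K s) (σ x))
    (hdeg : ∀ k, ldSeq σ K s (k + 1) = ldSeq σ K s k)
    (f₁ : partialDiffAdj σ K s 1 →+* V)
    (hσ : ∀ x (hx : x ∈ partialDiffAdj σ K s 0),
      f₁ ⟨σ x, map_partialDiffAdj_le σ hK s 0 ⟨x, hx, rfl⟩⟩ =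
        γ (f₁ ⟨x, partialDiffAdj_mono σ K s zero_le_one hx⟩)) :
    ∃ f : diffAdj σ K s →+* V,
      (∀ x : partialDiffAdj σ K s 1, f ⟨x, (mem_diffAdj_iff σ K s x).2 ⟨1, x.2⟩⟩ = f₁ x) ∧
      ∀ x : diffAdj σ K s, f ⟨σ x, map_diffAdj_le σ hK x.2⟩ = γ (f x) := by
  let P (k : ℕ) : Type _ :=
    { p : (partialDiffAdj σ K s k →+* V) × (partialDiffAdj σ K s (k + 1) →+* V) //
      (∀ x, p.2 (Subfield.inclusion (partialDiffAdj_mono σ K s k.le_succ) x) = p.1 x) ∧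
      ∀ x : partialDiffAdj σ K s k,
        p.2 ⟨σ x, map_partialDiffAdj_le σ hK s k ⟨x, x.2, rfl⟩⟩ = γ (p.1 x) }
  have hnext : ∀ k (p : P k), ∃ q : P (k + 1), q.1.1 = p.1.2 := by
    rintro k ⟨⟨f, f'⟩, h1, h2⟩
    obtain ⟨f'', h⟩ := exists_equivariant_extension σ γ hK hfin hs k (hdeg k) f f' h1 h2
    exact ⟨⟨(f', f''), h⟩, rfl⟩
  choose next hnext using hnext
  let p₀ : P 0 := ⟨(f₁.comp (Subfield.inclusion (partialDiffAdj_mono σ K s zero_le_one)), f₁),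
    fun _ => rfl, fun x => hσ x x.2⟩
  let p : ∀ k, P k := fun k => Nat.rec p₀ next k
  have hp : ∀ k, (p (k + 1)).1.1 = (p k).1.2 := fun k => hnext k (p k)
  obtain ⟨f, hf⟩ := exists_ringHom_of_chain (partialDiffAdj_mono σ K s) (mem_diffAdj_iff σ K s)
    (fun k => (p k).1.1) (fun k x => by
      rw [hp]
      exact (p k).2.1 x)
  refine ⟨f, fun x => (hf 1 x).trans (DFunLike.congr_fun (hp 0) x), fun x => ?_⟩
  obtain ⟨k, hk⟩ := (mem_diffAdj_iff σ K s x).1 x.2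
  refine (hf (k + 1) ⟨σ x, map_partialDiffAdj_le σ hK s k ⟨x, hk, rfl⟩⟩).trans ?_
  rw [hp]
  refine ((p k).2.2 ⟨x, hk⟩).trans ?_
  exact congrArg γ (hf k ⟨x, hk⟩).symm

end LimitDegree

/-- The relative algebraic closure of `E` is relatively algebraically closed. -/
theorem isAlgebraic_of_isAlgebraic_closure {E A : Subfield U}
    (hA : ∀ x : U, x ∈ A ↔ IsAlgebraic E x) {x : U} (hx : IsAlgebraic A x) : x ∈ A := by
  have hle : E ≤ A := fun y hy => (hA y).2 (isAlgebraic_algebraMap (⟨y, hy⟩ : E))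
  let _ : Algebra E A := (Subfield.inclusion hle).toAlgebra
  have : IsScalarTower E A U := IsScalarTower.of_algebraMap_eq fun _ => rfl
  have : Algebra.IsAlgebraic E A := ⟨fun y =>
    (isAlgebraic_algebraMap_iff (algebraMap A U).injective).1 ((hA y).1 y.2)⟩
  exact (hA x).2 (hx.restrictScalars E)

end DifferenceField

/-- if `μ(σ(a)/K(a)) = ld(a/K)` and `τ` is an automorphism of
`A = K(a)^alg` fixing `K(a)` pointwise, then the difference fields
`(K(a)_σ, σ)` and `(K(a)_{στ}, στ)` are isomorphic over `K`, by an isomorphism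
sending `a` to `a`.  Here `g : U → U` realises `στ` (i.e. `g = σ ∘ τ` on `A`;
note that `σ` maps `A` into itself), `K(a)_{στ} = K(g^i(a) : i ∈ ℕ)`, and the
isomorphism is presented as a (necessarily injective) ring homomorphism
`f : K(a)_σ → U` whose image is exactly `K(a)_{στ}`, fixing `K` pointwise,
with `f(a) = a` and `f ∘ σ = (στ) ∘ f`. -/
theorem stmt18 [Field U] [IsAlgClosed U] (σ : U ≃+* U) (K : Subfield U)
    (hK : K.map σ.toRingHom = K) {n : ℕ} (a : Fin n → U)
    (ha : ∀ i, IsAlgebraic (fAdj K (Set.range a)) (σ (a i)))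
    (La : ℕ) (hLa : ∀ᶠ k in atTop, ldSeq σ K (Set.range a) k = La)
    (hmu : deg (fAdj K (Set.range a)) (⇑σ '' Set.range a) = La)
    -- `A` is the relative algebraic closure `K(a)^alg` of `K(a)` in `U`
    (A : Subfield U) (hA : ∀ x : U, x ∈ A ↔ IsAlgebraic (fAdj K (Set.range a)) x)
    -- `τ` is a field automorphism of `K(a)^alg` fixing `K(a)` pointwise
    (τ : A ≃+* A)
    (hτ : ∀ x : A, (x : U) ∈ fAdj K (Set.range a) → ((τ x : A) : U) = (x : U))
    -- `g` realises `στ` as a map on `U`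
    (g : U → U) (hg : ∀ x : A, g (x : U) = σ ((τ x : A) : U)) :
    ∃ f : (diffAdj σ K (Set.range a)) →+* U,
      Set.range ⇑f = ↑(fAdj K (⋃ i : ℕ, Set.range fun j => g^[i] (a j))) ∧
      (∀ x : (diffAdj σ K (Set.range a)), (x : U) ∈ K → f x = (x : U)) ∧
      (∀ (j : Fin n) (hx : a j ∈ diffAdj σ K (Set.range a)), f ⟨a j, hx⟩ = a j) ∧
      (∀ (x : (diffAdj σ K (Set.range a))) (hx : σ (x : U) ∈ diffAdj σ K (Set.range a)),
        f ⟨σ (x : U), hx⟩ = g (f x)) := by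
  set s := Set.range a with hs_def
  have hs : ∀ x ∈ s, IsAlgebraic (fAdj K s) (σ x) := by
    rintro _ ⟨i, rfl⟩
    exact ha i
  have hfin : s.Finite := Set.finite_range a
  have hdeg := ldSeq_eq σ hK.le hfin hs hLa hmu
  have hEA : fAdj K s ≤ A := fun y hy => (hA y).2 (isAlgebraic_algebraMap (⟨y, hy⟩ : fAdj K s))
  have hKA : K ≤ A := (le_fAdj K s).trans hEA
  have hσE : (fAdj K s).map σ.toRingHom ≤ A := by
    rw [map_fAdj, hK]
    refine fAdj_le hKA ?_
    rintro _ ⟨x, hx, rfl⟩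
    exact (hA _).2 (hs x hx)
  have hσA : ∀ x ∈ A, σ x ∈ A := fun x hx =>
    isAlgebraic_of_isAlgebraic_closure hA (isAlgebraic_mono hσE (isAlgebraic_map σ ((hA x).1 hx)))
  let γ : A →+* A :=
    ((σ.toRingHom.comp A.subtype).codRestrict A fun x => hσA x x.2).comp τ.toRingHom
  have hγ : ∀ x : A, (γ x : U) = g x := fun x => (hg x).symm
  have h₁A : partialDiffAdj σ K s 1 ≤ A := by
    rw [partialDiffAdj_succ, partialDiffAdj_zero]
    refine fAdj_le hEA ?_
    rintro _ ⟨x, hx, rfl⟩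
    exact (hA _).2 (hs x hx)
  obtain ⟨f, hf₁, hfσ⟩ := exists_equivariant_ringHom σ γ hK.le hfin hs
    (fun k => (hdeg (k + 1)).trans (hdeg k).symm) (Subfield.inclusion h₁A) (fun x hx => by
      rw [partialDiffAdj_zero] at hx
      refine Subtype.ext ?_
      exact congrArg σ (hτ ⟨x, hEA hx⟩ hx).symm)
  have hKs : fAdj K s ≤ partialDiffAdj σ K s 1 :=
    (partialDiffAdj_zero σ K s).ge.trans (partialDiffAdj_mono σ K s zero_le_one)
  have hfix : ∀ x : diffAdj σ K s, (x : U) ∈ fAdj K s → (f x : U) = x := fun x hx =>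
    congrArg Subtype.val (hf₁ ⟨x, hKs hx⟩)
  have hmem : ∀ i j, (σ ^ i) (a j) ∈ diffAdj σ K s := fun i j =>
    subset_fAdj K _ (mem_iUnion.2 ⟨i, mem_image_of_mem _ (mem_range_self j)⟩)
  have horbit : ∀ i j, (f ⟨(σ ^ i) (a j), hmem i j⟩ : U) = g^[i] (a j) := by
    intro i j
    induction i with
    | zero => exact hfix ⟨a j, hmem 0 j⟩ (subset_fAdj K s (mem_range_self j))
    | succ i ih =>
      rw [Function.iterate_succ_apply', ← ih, ← hγ, ← hfσ]
      congr 3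
      rw [pow_succ']
      rfl
  refine ⟨A.subtype.comp f, ?_, fun x hx => hfix x (le_fAdj K s hx),
    fun j hx => hfix ⟨a j, hx⟩ (subset_fAdj K s (mem_range_self j)), fun x hx => ?_⟩
  · rw [← RingHom.coe_fieldRange]
    refine congrArg _ (le_antisymm ?_ (fAdj_le ?_ ?_))
    · have hle : diffAdj σ K s ≤ ((fAdj K (⋃ i : ℕ, Set.range fun j => g^[i] (a j))).comap
          (A.subtype.comp f)).map (diffAdj σ K s).subtype := by
        refine fAdj_le (fun x hx => ?_) (iUnion_subset fun i => ?_)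
        · refine ⟨⟨x, le_fAdj K _ hx⟩, ?_, rfl⟩
          change (f _ : U) ∈ fAdj K _
          rw [hfix ⟨x, le_fAdj K _ hx⟩ (le_fAdj K s hx)]
          exact le_fAdj K _ hx
        · rintro _ ⟨_, ⟨j, rfl⟩, rfl⟩
          refine ⟨⟨_, hmem i j⟩, ?_, rfl⟩
          change (f _ : U) ∈ fAdj K _
          rw [horbit]
          exact subset_fAdj K _ (mem_iUnion.2 ⟨i, mem_range_self j⟩)
      rintro _ ⟨x, rfl⟩
      obtain ⟨y, hy, hyx⟩ := hle x.2
      obtain rfl : y = x := Subtype.ext hyx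
      exact hy
    · exact fun x hx => ⟨⟨x, le_fAdj K _ hx⟩, hfix _ (le_fAdj K s hx)⟩
    · refine iUnion_subset fun i => ?_
      rintro _ ⟨j, rfl⟩
      exact ⟨⟨_, hmem i j⟩, horbit i j⟩
  · exact (congrArg Subtype.val (hfσ x)).trans (hγ _)
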